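/- Let N be a positive integer, V an N×N real symmetric positive definite matrix, ζ ∈ (0,1), and let γ := N(0, V) be the centered multivariate Gaussian measure on ℝ^N. Let Φ : ℝ^N → [0, ∞) be measurable, set Z := ∫ exp(−Φ(x)) dγ(x) (which satisfies 0 < Z ≤ 1), and define the posterior probability measure ν on ℝ^N by dν/dγ = exp(−Φ)/Z. Define the proposal map p(x, ξ) := √(1−ζ²)·x + ζ·ξ and the acceptance probability a(x, x̃) := min{1, exp(Φ(x) − Φ(x̃))}. Then for every bounded measurable f : ℝ^N × ℝ^N → ℝ, ∫_{ℝ^N} ∫_{ℝ^N} [ a(x, p(x,ξ)) f(x, p(x,ξ)) + (1 − a(x, p(x,ξ))) f(x, x) ] dγ(ξ) dν(x) = ∫_{ℝ^N} ∫_{ℝ^N} [ a(x, p(x,ξ)) f(p(x,ξ), x) + (1 − a(x, p(x,ξ))) f(x, x) ] dγ(ξ) dν(x). In other words, the Metropolis–Hastings transition kernel of the graph pCN algorithm is reversible with respect to the posterior ν. -/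

import Mathlib

open MeasureTheory ProbabilityTheory

/-- The density of the centered multivariate Gaussian `N(0, V)` on `ℝ^N`:
`x ↦ ((2π)^N det V)^{-1/2} exp(-½ xᵀ V⁻¹ x)`. -/
noncomputable def gaussianDensity (N : ℕ) (V : Matrix (Fin N) (Fin N) ℝ)
    (x : EuclideanSpace ℝ (Fin N)) : ℝ :=
  ((2 * Real.pi) ^ N * V.det) ^ (-(1/2 : ℝ)) *
    Real.exp (-(1/2) * ∑ i, ∑ j, x i * V⁻¹ i j * x j)

/-- The centered multivariate Gaussian measure `N(0, V)` on `ℝ^N`, defined by its density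
with respect to Lebesgue measure. -/
noncomputable def gaussianMeasure (N : ℕ) (V : Matrix (Fin N) (Fin N) ℝ) :
    Measure (EuclideanSpace ℝ (Fin N)) :=
  volume.withDensity (fun x => ENNReal.ofReal (gaussianDensity N V x))

open scoped MatrixOrder Matrix.Norms.L2Operator in
lemma Matrix.PosSemidef.exists_eq_transpose_mul_self {ι : Type*} [Fintype ι] [DecidableEq ι]
    {A : Matrix ι ι ℝ} (hA : A.PosSemidef) : ∃ B : Matrix ι ι ℝ, A = B.transpose * B := by
  obtain ⟨B, hB⟩ := CStarAlgebra.nonneg_iff_eq_star_mul_self.mp hA.nonneg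
  exact ⟨B, by rw [hB, star_eq_conjTranspose, conjTranspose_eq_transpose_of_trivial]⟩

/-- The quadratic form of `V⁻¹` is the squared norm of a linear image. -/
lemma exists_linearMap_norm_sq_eq_quadraticForm_inv {N : ℕ} {V : Matrix (Fin N) (Fin N) ℝ}
    (hV : V.PosDef) :
    ∃ L : EuclideanSpace ℝ (Fin N) →ₗ[ℝ] EuclideanSpace ℝ (Fin N),
      LinearMap.det L ^ 2 = V.det⁻¹ ∧
      ∀ x : EuclideanSpace ℝ (Fin N), ∑ i, ∑ j, x i * V⁻¹ i j * x j = ‖L x‖ ^ 2 := by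
  obtain ⟨B, hB⟩ := hV.inv.posSemidef.exists_eq_transpose_mul_self
  refine ⟨Matrix.toEuclideanLin B, ?_, fun x => ?_⟩
  · have hdet : LinearMap.det (Matrix.toEuclideanLin B) = B.det := by
      rw [Matrix.toEuclideanLin_eq_toLin_orthonormal, LinearMap.det_toLin]
    rw [hdet, ← Ring.inverse_eq_inv', ← Matrix.det_nonsing_inv, hB, Matrix.det_mul,
      Matrix.det_transpose, sq]
  · rw [EuclideanSpace.norm_sq_eq]
    simp only [Matrix.toLpLin_apply, Real.norm_eq_abs, sq_abs]
    have h := Matrix.dotProduct_mulVec x.ofLp B.transpose (B.mulVec x.ofLp)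
    rw [Matrix.mulVec_mulVec, ← hB, Matrix.vecMul_transpose] at h
    simpa [dotProduct, Matrix.mulVec, Finset.mul_sum, sq, mul_assoc] using h

@[fun_prop]
lemma measurable_gaussianDensity (N : ℕ) (V : Matrix (Fin N) (Fin N) ℝ) :
    Measurable (gaussianDensity N V) := by
  unfold gaussianDensity
  fun_prop

lemma gaussianDensity_nonneg {N : ℕ} {V : Matrix (Fin N) (Fin N) ℝ} (hV : V.PosDef)
    (x : EuclideanSpace ℝ (Fin N)) : 0 ≤ gaussianDensity N V x := by
  have := hV.det_pos
  unfold gaussianDensity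
  positivity

lemma integral_gaussianDensity {N : ℕ} {V : Matrix (Fin N) (Fin N) ℝ} (hV : V.PosDef) :
    ∫ x, gaussianDensity N V x = 1 := by
  obtain ⟨L, hdet, hL⟩ := exists_linearMap_norm_sq_eq_quadraticForm_inv hV
  have hVdet := hV.det_pos
  have hL0 : LinearMap.det L ≠ 0 := by
    intro h
    rw [h, zero_pow two_ne_zero] at hdet
    exact (inv_pos.2 hVdet).ne hdet
  have habs : |(LinearMap.det L)⁻¹| = V.det ^ (1 / 2 : ℝ) := by
    rw [← Real.sqrt_eq_rpow, ← inv_inv V.det, ← hdet, ← inv_pow, Real.sqrt_sq_eq_abs]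
  have hmap := Measure.map_linearMap_addHaar_eq_smul_addHaar
    (volume : Measure (EuclideanSpace ℝ (Fin N))) hL0
  have hcomp : ∫ x, Real.exp (-(1 / 2) * ‖L x‖ ^ 2)
      = V.det ^ (1 / 2 : ℝ) * (2 * Real.pi) ^ (N / 2 : ℝ) := by
    have h1 := integral_map (μ := (volume : Measure (EuclideanSpace ℝ (Fin N))))
      (φ := L) (f := fun y => Real.exp (-(1 / 2) * ‖y‖ ^ 2))
      L.continuous_of_finiteDimensional.measurable.aemeasurable
      (Continuous.aestronglyMeasurable (by fun_prop))
    rw [← h1, hmap, integral_smul_measure, ENNReal.toReal_ofReal (abs_nonneg _), habs,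
      GaussianFourier.integral_rexp_neg_mul_sq_norm (by norm_num : (0 : ℝ) < 1 / 2),
      finrank_euclideanSpace_fin, smul_eq_mul]
    congr 2
    ring
  unfold gaussianDensity
  simp_rw [hL]
  rw [integral_const_mul, hcomp, Real.mul_rpow (by positivity) hVdet.le, ← Real.rpow_natCast,
    ← Real.rpow_mul (by positivity), mul_mul_mul_comm, mul_comm (V.det ^ _), mul_mul_mul_comm,
    ← Real.rpow_add (by positivity), ← Real.rpow_add hVdet]
  have h : (N : ℝ) * -(1 / 2) + N / 2 = 0 := by ring
  rw [h, add_neg_cancel, Real.rpow_zero, Real.rpow_zero, one_mul]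

lemma isProbabilityMeasure_gaussianMeasure {N : ℕ} {V : Matrix (Fin N) (Fin N) ℝ}
    (hV : V.PosDef) : IsProbabilityMeasure (gaussianMeasure N V) := by
  constructor
  have h := integral_gaussianDensity hV
  have hint : Integrable (gaussianDensity N V) := by
    by_contra hn
    rw [integral_undef hn] at h
    exact zero_ne_one h
  rw [gaussianMeasure, withDensity_apply _ MeasurableSet.univ, Measure.restrict_univ,
    ← ofReal_integral_eq_lintegral_ofReal hint
      (Filter.Eventually.of_forall (gaussianDensity_nonneg hV)), h, ENNReal.ofReal_one]

/-- The reflection `(x, ξ) ↦ (c x + s ξ, s x - c ξ)`. -/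
def reflectionProd (E : Type*) [AddCommGroup E] [Module ℝ E] (c s : ℝ) : E × E →ₗ[ℝ] E × E :=
  (c • LinearMap.fst ℝ E E + s • LinearMap.snd ℝ E E).prod
    (s • LinearMap.fst ℝ E E - c • LinearMap.snd ℝ E E)

lemma reflectionProd_apply {E : Type*} [AddCommGroup E] [Module ℝ E] (c s : ℝ) (z : E × E) :
    reflectionProd E c s z = (c • z.1 + s • z.2, s • z.1 - c • z.2) := rfl

lemma reflectionProd_reflectionProd {E : Type*} [AddCommGroup E] [Module ℝ E] {c s : ℝ}
    (h : c ^ 2 + s ^ 2 = 1) (z : E × E) :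
    reflectionProd E c s (reflectionProd E c s z) = z := by
  ext
  · calc c • (c • z.1 + s • z.2) + s • (s • z.1 - c • z.2)
        = (c ^ 2 + s ^ 2) • z.1 := by module
      _ = z.1 := by rw [h, one_smul]
  · calc s • (c • z.1 + s • z.2) - c • (s • z.1 - c • z.2)
        = (c ^ 2 + s ^ 2) • z.2 := by module
      _ = z.2 := by rw [h, one_smul]

lemma measurePreserving_reflectionProd_volume {E : Type*} [NormedAddCommGroup E]
    [InnerProductSpace ℝ E] [FiniteDimensional ℝ E] [MeasurableSpace E] [BorelSpace E]
    {c s : ℝ} (h : c ^ 2 + s ^ 2 = 1) :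
    MeasurePreserving (reflectionProd E c s) (volume.prod volume) (volume.prod volume) := by
  refine ⟨(reflectionProd E c s).continuous_of_finiteDimensional.measurable, ?_⟩
  have hdet : LinearMap.det (reflectionProd E c s) * LinearMap.det (reflectionProd E c s) = 1 := by
    rw [← LinearMap.det_comp]
    convert! LinearMap.det_id
    exact LinearMap.ext (reflectionProd_reflectionProd h)
  have h0 : LinearMap.det (reflectionProd E c s) ≠ 0 := left_ne_zero_of_mul_eq_one hdet
  have habs : |(LinearMap.det (reflectionProd E c s))⁻¹| = 1 := by
    rcases mul_self_eq_one_iff.1 hdet with h | h <;> simp [h]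
  rw [Measure.map_linearMap_addHaar_eq_smul_addHaar _ h0, habs, ENNReal.ofReal_one, one_smul]

lemma gaussianDensity_mul_gaussianDensity_reflectionProd {N : ℕ}
    {V : Matrix (Fin N) (Fin N) ℝ} (hV : V.PosDef) {c s : ℝ} (h : c ^ 2 + s ^ 2 = 1)
    (z : EuclideanSpace ℝ (Fin N) × EuclideanSpace ℝ (Fin N)) :
    gaussianDensity N V (reflectionProd _ c s z).1 * gaussianDensity N V (reflectionProd _ c s z).2
      = gaussianDensity N V z.1 * gaussianDensity N V z.2 := by
  obtain ⟨L, -, hL⟩ := exists_linearMap_norm_sq_eq_quadraticForm_inv hV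
  have key : ‖L (c • z.1 + s • z.2)‖ ^ 2 + ‖L (s • z.1 - c • z.2)‖ ^ 2
      = ‖L z.1‖ ^ 2 + ‖L z.2‖ ^ 2 := by
    simp only [map_add, map_sub, map_smul, norm_add_sq_real, norm_sub_sq_real, norm_smul,
      real_inner_smul_left, real_inner_smul_right, mul_pow, Real.norm_eq_abs, sq_abs]
    linear_combination (‖L z.1‖ ^ 2 + ‖L z.2‖ ^ 2) * h
  simp only [gaussianDensity, hL, reflectionProd_apply]
  rw [mul_mul_mul_comm, ← Real.exp_add, ← mul_add, key, mul_mul_mul_comm, ← Real.exp_add,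
    ← mul_add]

lemma MeasureTheory.MeasurePreserving.withDensity_of_comp_eq {α : Type*} [MeasurableSpace α]
    {μ : Measure α} {T : α → α} (hT : MeasurePreserving T μ μ) {d : α → ENNReal}
    (hd : Measurable d) (hdT : ∀ x, d (T x) = d x) :
    MeasurePreserving T (μ.withDensity d) (μ.withDensity d) := by
  refine ⟨hT.measurable, Measure.ext fun A hA => ?_⟩
  rw [Measure.map_apply hT.measurable hA, withDensity_apply _ (hT.measurable hA),
    withDensity_apply _ hA, ← hT.setLIntegral_comp_preimage hA hd]
  simp_rw [hdT]

lemma measurePreserving_reflectionProd_gaussianMeasure {N : ℕ} {V : Matrix (Fin N) (Fin N) ℝ}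
    (hV : V.PosDef) {c s : ℝ} (h : c ^ 2 + s ^ 2 = 1) :
    MeasurePreserving (reflectionProd (EuclideanSpace ℝ (Fin N)) c s)
      ((gaussianMeasure N V).prod (gaussianMeasure N V))
      ((gaussianMeasure N V).prod (gaussianMeasure N V)) := by
  rw [gaussianMeasure, prod_withDensity (by fun_prop) (by fun_prop)]
  refine (measurePreserving_reflectionProd_volume h).withDensity_of_comp_eq (by fun_prop) ?_
  intro z
  rw [← ENNReal.ofReal_mul (gaussianDensity_nonneg hV _),
    ← ENNReal.ofReal_mul (gaussianDensity_nonneg hV _),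
    gaussianDensity_mul_gaussianDensity_reflectionProd hV h]

/-- The integral of a Metropolis–Hastings step against the tilted measure, as an integral over the
product space split into its accepted and rejected parts. -/
lemma integral_integral_withDensity_accept_reject {E : Type*} [MeasurableSpace E] {γ : Measure E}
    [IsProbabilityMeasure γ] {w : E → ℝ} (hw : Measurable w) (hw0 : ∀ x, 0 ≤ w x) {K : ℝ}
    (hwK : ∀ x, w x ≤ K) {α g r : E × E → ℝ} (hα : Measurable α) (hα0 : ∀ z, 0 ≤ α z)
    (hα1 : ∀ z, α z ≤ 1) (hg : Measurable g) (hr : Measurable r) {C : ℝ} (hgC : ∀ z, |g z| ≤ C)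
    (hrC : ∀ z, |r z| ≤ C) :
    ∫ x, ∫ ξ, (α (x, ξ) * g (x, ξ) + (1 - α (x, ξ)) * r (x, ξ)) ∂γ
        ∂(γ.withDensity fun x => ENNReal.ofReal (w x))
      = ∫ z, w z.1 * α z * g z ∂(γ.prod γ) + ∫ z, w z.1 * (1 - α z) * r z ∂(γ.prod γ) := by
  have bdd : ∀ β k : E × E → ℝ, Measurable β → (∀ z, 0 ≤ β z) → (∀ z, β z ≤ 1) → Measurable k →
      (∀ z, |k z| ≤ C) → Integrable (fun z => w z.1 * β z * k z) (γ.prod γ) := by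
    intro β k hβ hβ0 hβ1 hk hkC
    refine Integrable.of_bound (by fun_prop) (K * 1 * C) (Filter.Eventually.of_forall fun z => ?_)
    have h0 := hw0 z.1
    have h1 := hwK z.1
    rw [Real.norm_eq_abs, abs_mul, abs_of_nonneg (mul_nonneg h0 (hβ0 z))]
    exact mul_le_mul (mul_le_mul h1 (hβ1 z) (hβ0 z) (h0.trans h1)) (hkC z) (abs_nonneg _)
      (by linarith)
  have hi1 := bdd α g hα hα0 hα1 hg hgC
  have hi2 := bdd (fun z => 1 - α z) r (by fun_prop) (fun z => sub_nonneg.2 (hα1 z))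
    (fun z => sub_le_self _ (hα0 z)) hr hrC
  rw [← integral_add hi1 hi2, integral_prod (fun z => _ + _) (hi1.add hi2),
    integral_withDensity_eq_integral_toReal_smul (by fun_prop)
      (Filter.Eventually.of_forall fun _ => ENNReal.ofReal_lt_top)]
  refine integral_congr_ae (Filter.Eventually.of_forall fun x => ?_)
  simp only [ENNReal.toReal_ofReal (hw0 x), smul_eq_mul]
  rw [← integral_const_mul]
  refine integral_congr_ae (Filter.Eventually.of_forall fun ξ => ?_)
  simp only
  ring

/-- Reversibility of the graph pCN Metropolis–Hastings kernel with respect to the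
posterior `ν` with `dν/dγ = exp(-Φ)/Z`, `γ = N(0,V)`: the normalizing constant satisfies
`0 < Z ≤ 1`, and for every bounded measurable `f`, the two-step integral of the accept/reject
dynamics is symmetric under swapping the arguments of `f` at accepted proposals. -/
theorem stmt_11 (N : ℕ) (hN : 0 < N) (V : Matrix (Fin N) (Fin N) ℝ)
    (hVsymm : V.IsSymm) (hV : V.PosDef) (ζ : ℝ) (hζ : ζ ∈ Set.Ioo (0:ℝ) 1)
    (Φ : EuclideanSpace ℝ (Fin N) → ℝ) (hΦmeas : Measurable Φ) (hΦ0 : ∀ x, 0 ≤ Φ x) :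
    let γ : Measure (EuclideanSpace ℝ (Fin N)) := gaussianMeasure N V
    let Z : ℝ := ∫ x, Real.exp (-Φ x) ∂γ
    let ν : Measure (EuclideanSpace ℝ (Fin N)) :=
      γ.withDensity (fun x => ENNReal.ofReal (Real.exp (-Φ x) / Z))
    let p : EuclideanSpace ℝ (Fin N) → EuclideanSpace ℝ (Fin N) → EuclideanSpace ℝ (Fin N) :=
      fun x ξ => Real.sqrt (1 - ζ^2) • x + ζ • ξ
    let a : EuclideanSpace ℝ (Fin N) → EuclideanSpace ℝ (Fin N) → ℝ :=
      fun x x' => min 1 (Real.exp (Φ x - Φ x'))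
    (0 < Z ∧ Z ≤ 1) ∧
    ∀ f : EuclideanSpace ℝ (Fin N) × EuclideanSpace ℝ (Fin N) → ℝ,
      Measurable f → (∃ C : ℝ, ∀ q, |f q| ≤ C) →
      (∫ x, ∫ ξ, (a x (p x ξ) * f (x, p x ξ) + (1 - a x (p x ξ)) * f (x, x)) ∂γ ∂ν)
        = ∫ x, ∫ ξ, (a x (p x ξ) * f (p x ξ, x) + (1 - a x (p x ξ)) * f (x, x)) ∂γ ∂ν := by
  intro γ Z ν p a
  have hγ : IsProbabilityMeasure γ := isProbabilityMeasure_gaussianMeasure hV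
  have hexp : ∀ x, Real.exp (-Φ x) ≤ 1 := fun x => Real.exp_le_one_iff.2 (neg_nonpos.2 (hΦ0 x))
  have hint : Integrable (fun x => Real.exp (-Φ x)) γ :=
    Integrable.of_bound (by fun_prop) 1 (Filter.Eventually.of_forall fun x => by
      rw [Real.norm_eq_abs, Real.abs_exp]
      exact hexp x)
  have hZ : 0 < Z := integral_exp_pos hint
  refine ⟨⟨hZ, ?_⟩, ?_⟩
  · calc Z ≤ ∫ _, (1 : ℝ) ∂γ := integral_mono hint (integrable_const _) hexp
      _ = 1 := by simp
  rintro f hf ⟨C, hC⟩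
  have hcs : Real.sqrt (1 - ζ ^ 2) ^ 2 + ζ ^ 2 = 1 := by
    rw [Real.sq_sqrt (by nlinarith [hζ.1, hζ.2])]
    ring
  have ha0 : ∀ x x', 0 ≤ a x x' := fun x x' => le_min zero_le_one (Real.exp_pos _).le
  have ha1 : ∀ x x', a x x' ≤ 1 := fun x x' => min_le_left _ _
  have hsymm : ∀ x x', Real.exp (-Φ x) / Z * a x x' = Real.exp (-Φ x') / Z * a x' x := by
    have h : ∀ x x', Real.exp (-Φ x) * a x x' = min (Real.exp (-Φ x)) (Real.exp (-Φ x')) := by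
      intro x x'
      rw [mul_min_of_nonneg _ _ (Real.exp_pos _).le, mul_one, ← Real.exp_add]
      congr 2
      ring
    intro x x'
    rw [div_mul_eq_mul_div, div_mul_eq_mul_div, h, h, min_comm]
  have hstep := fun (g : EuclideanSpace ℝ (Fin N) × EuclideanSpace ℝ (Fin N) → ℝ)
      (hg : Measurable g) (hgC : ∀ z, |g z| ≤ C) =>
    integral_integral_withDensity_accept_reject (γ := γ) (w := fun x => Real.exp (-Φ x) / Z)
      (by fun_prop) (fun x => by positivity) (K := 1 / Z)
      (fun x => div_le_div_of_nonneg_right (hexp x) hZ.le)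
      (α := fun z => a z.1 (p z.1 z.2)) (g := g) (r := fun z => f (z.1, z.1))
      (by fun_prop) (fun z => ha0 _ _) (fun z => ha1 _ _) hg (by fun_prop) hgC (fun z => hC _)
  refine (hstep (fun z => f (z.1, p z.1 z.2)) (by fun_prop) (fun z => hC _)).trans
    (Eq.trans ?_ (hstep (fun z => f (p z.1 z.2, z.1)) (by fun_prop) (fun z => hC _)).symm)
  congr 1
  have hT := measurePreserving_reflectionProd_gaussianMeasure hV hcs
  have hTT := reflectionProd_reflectionProd (E := EuclideanSpace ℝ (Fin N)) hcs
  have hcomp := integral_map (μ := γ.prod γ) hT.measurable.aemeasurable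
    (f := fun z => Real.exp (-Φ z.1) / Z * a z.1 (p z.1 z.2) * f (z.1, p z.1 z.2))
    (Measurable.aestronglyMeasurable (by fun_prop))
  rw [hT.map_eq] at hcomp
  refine hcomp.trans (integral_congr_ae (Filter.Eventually.of_forall fun z => ?_))
  have h1 : (reflectionProd _ (Real.sqrt (1 - ζ ^ 2)) ζ z).1 = p z.1 z.2 := rfl
  have h2 : p (reflectionProd _ (Real.sqrt (1 - ζ ^ 2)) ζ z).1
      (reflectionProd _ (Real.sqrt (1 - ζ ^ 2)) ζ z).2 = z.1 := congrArg Prod.fst (hTT z)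
  simp only [h2]
  rw [h1, hsymm]
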